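/- For fixed r₁ ∈ (0,1), fixed order ν ≥ 0, and σ₁, σ₂ > 0: if for all n the multipliers (I_ν(r₁/√σ₁) D_{0,1}(1,r₁) − σ₁ I_ν'(r₁/√σ₁) D(1,r₁)) / (I_ν(r₁/√σ₁) D_{1,1}(1,r₁) − σ₁ I_ν'(r₁/√σ₁) D_{1,0}(1,r₁)) coincide for σ₁ and σ₂ (with nonzero denominators), then σ₁ = σ₂. -/

import Mathlib

/-- Modified Bessel function of the first kind of order ν. -/
noncomputable def besselI (ν : ℝ) (x : ℝ) : ℝ :=
  ∑' k : ℕ, (x / 2) ^ (ν + 2 * (k : ℝ)) / ((Nat.factorial k : ℝ) * Real.Gamma (ν + (k : ℝ) + 1))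

/-- Modified Bessel function of the second kind of order ν. -/
noncomputable def besselK (ν : ℝ) (x : ℝ) : ℝ :=
  ∫ t in Set.Ioi (0 : ℝ), Real.exp (-x * Real.cosh t) * Real.cosh (ν * t)

/-- D(x,y) = I_ν(x)K_ν(y) − K_ν(x)I_ν(y). -/
noncomputable def D (ν x y : ℝ) : ℝ := besselI ν x * besselK ν y - besselK ν x * besselI ν y

noncomputable def D10 (ν x y : ℝ) : ℝ :=
  deriv (besselI ν) x * besselK ν y - deriv (besselK ν) x * besselI ν y

noncomputable def D01 (ν x y : ℝ) : ℝ :=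
  besselI ν x * deriv (besselK ν) y - besselK ν x * deriv (besselI ν) y

noncomputable def D11 (ν x y : ℝ) : ℝ :=
  deriv (besselI ν) x * deriv (besselK ν) y - deriv (besselK ν) x * deriv (besselI ν) y

/-- Coefficients of the entire part of the Bessel series. -/
noncomputable def bC (ν : ℝ) (k : ℕ) : ℝ := 1 / ((Nat.factorial k : ℝ) * Real.Gamma (ν + (k : ℝ) + 1))

/-- Entire part of the Bessel function. -/
noncomputable def bU (ν y : ℝ) : ℝ := ∑' k : ℕ, bC ν k * y ^ k

lemma bGamma_pos {ν : ℝ} (hν : 0 ≤ ν) (k : ℕ) : 0 < Real.Gamma (ν + (k : ℝ) + 1) :=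
  Real.Gamma_pos_of_pos (by positivity)

lemma bC_pos {ν : ℝ} (hν : 0 ≤ ν) (k : ℕ) : 0 < bC ν k := by
  have := bGamma_pos hν k
  unfold bC; positivity

lemma bGamma_ge {ν : ℝ} (hν : 0 ≤ ν) (k : ℕ) :
    Real.Gamma (ν + 1) ≤ Real.Gamma (ν + (k : ℝ) + 1) := by
  induction k with
  | zero => simp
  | succ k ih =>
    refine ih.trans ?_
    have h1 : ν + ((k + 1 : ℕ) : ℝ) + 1 = (ν + k + 1) + 1 := by push_cast; ring
    rw [h1, Real.Gamma_add_one (s := ν + k + 1) (by positivity)]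
    have := bGamma_pos hν k
    have hk : (0:ℝ) ≤ k := by positivity
    nlinarith

lemma bC_le {ν : ℝ} (hν : 0 ≤ ν) (k : ℕ) :
    bC ν k ≤ (1 / Real.Gamma (ν + 1)) * (1 / (Nat.factorial k : ℝ)) := by
  have h0 : 0 < Real.Gamma (ν + 1) := Real.Gamma_pos_of_pos (by positivity)
  have := bGamma_ge hν k
  unfold bC
  rw [one_div_mul_one_div, mul_comm (Real.Gamma (ν + 1))]
  gcongr

lemma bU_summable {ν : ℝ} (hν : 0 ≤ ν) (y : ℝ) : Summable fun k : ℕ => bC ν k * y ^ k := by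
  refine Summable.of_norm_bounded
    (g := fun k : ℕ => (1 / Real.Gamma (ν + 1)) * (|y| ^ k / (Nat.factorial k : ℝ)))
    ((Real.summable_pow_div_factorial |y|).mul_left _) ?_
  intro k
  rw [norm_mul, norm_pow, Real.norm_eq_abs, Real.norm_eq_abs, abs_of_pos (bC_pos hν k)]
  calc bC ν k * |y| ^ k ≤ ((1 / Real.Gamma (ν + 1)) * (1 / (Nat.factorial k : ℝ))) * |y| ^ k := by
        gcongr; exact bC_le hν k
    _ = _ := by ring

lemma bC_succ {ν : ℝ} (k : ℕ) : ((k : ℝ) + 1) * bC ν (k + 1) = bC (ν + 1) k := by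
  unfold bC
  have h1 : ν + ((k + 1 : ℕ) : ℝ) + 1 = ν + 1 + k + 1 := by push_cast; ring
  rw [h1, Nat.factorial_succ]
  push_cast
  have : (k : ℝ) + 1 ≠ 0 := by positivity
  field_simp

lemma bC_shift {ν : ℝ} (hν : 0 ≤ ν) (k : ℕ) : bC (ν + 1) k = bC ν k * (1 / (ν + k + 1)) := by
  unfold bC
  have h1 : ν + 1 + (k : ℝ) + 1 = (ν + k + 1) + 1 := by ring
  have h2 : (ν + k + 1) ≠ 0 := by positivity
  rw [h1, Real.Gamma_add_one h2]
  have := (bGamma_pos hν k).ne'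
  field_simp

lemma bU_pos {ν : ℝ} (hν : 0 ≤ ν) {y : ℝ} (hy : 0 < y) : 0 < bU ν y := by
  refine (bU_summable hν y).tsum_pos (fun k => ?_) 0 ?_
  · have := bC_pos hν k
    positivity
  · have := bC_pos hν 0
    positivity

lemma bU_hasDerivAt {ν : ℝ} (hν : 0 ≤ ν) (y : ℝ) : HasDerivAt (bU ν) (bU (ν + 1) y) y := by
  have hν1 : 0 ≤ ν + 1 := by linarith
  set R := |y| + 1 with hR
  have hR0 : 0 < R := by positivity
  have hsum : Summable fun k : ℕ => bC ν k * ((k : ℝ) * R ^ (k - 1)) := by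
    rw [← summable_nat_add_iff 1]
    refine (bU_summable hν1 R).congr ?_
    intro k
    rw [← bC_succ, Nat.add_sub_cancel]; push_cast; ring
  have key := hasDerivAt_tsum_of_isPreconnected (𝕜 := ℝ) (g := fun (k : ℕ) z => bC ν k * z ^ k)
    (g' := fun (k : ℕ) z => bC ν k * ((k : ℝ) * z ^ (k - 1))) hsum (t := Metric.ball (0:ℝ) R)
    Metric.isOpen_ball (convex_ball _ _).isPreconnected
    (fun k z _ => by simpa using (hasDerivAt_pow k z).const_mul (bC ν k))
    (fun k z hz => by
      have hz' : |z| ≤ R := by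
        have := Metric.mem_ball.1 hz
        rw [Real.dist_eq, sub_zero] at this
        exact this.le
      rw [norm_mul, norm_mul, norm_pow, Real.norm_eq_abs, Real.norm_eq_abs, Real.norm_eq_abs,
        abs_of_pos (bC_pos hν k), Nat.abs_cast]
      have := bC_pos hν k
      gcongr)
    (y₀ := 0) (by simpa using hR0) (bU_summable hν 0) (y := y)
    (by rw [Metric.mem_ball, Real.dist_eq, sub_zero]; linarith)
  have h2 : (∑' k : ℕ, bC ν k * ((k : ℝ) * y ^ (k - 1))) = bU (ν + 1) y := by
    rw [tsum_eq_zero_add']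
    · simp only [CharP.cast_eq_zero, zero_mul, mul_zero, zero_add]
      refine tsum_congr fun k => ?_
      rw [← bC_succ, Nat.add_sub_cancel]; push_cast; ring
    · refine (bU_summable hν1 y).congr ?_
      intro k
      rw [← bC_succ, Nat.add_sub_cancel]; push_cast; ring
  rw [h2] at key
  exact key

/-- Monotonicity of `U_{ν+1}/U_ν`, cross-multiplied. -/
lemma bU_ratio {ν : ℝ} (hν : 0 ≤ ν) {y z : ℝ} (hy : 0 < y) (hyz : y ≤ z) :
    bU (ν + 1) z * bU ν y ≤ bU (ν + 1) y * bU ν z := by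
  have hν1 : 0 ≤ ν + 1 := by linarith
  have hz : 0 < z := hy.trans_le hyz
  have hUy := bU_pos hν hy
  set l := bU (ν + 1) y / bU ν y with hl
  have hlpos : 0 < l := div_pos (bU_pos hν1 hy) hUy
  set t := z / y with ht
  have ht1 : 1 ≤ t := by rw [ht, one_le_div hy]; exact hyz
  have hex : ∃ k : ℕ, 1 / (ν + k + 1) ≤ l := by
    obtain ⟨k, hk⟩ := exists_nat_ge (1 / l)
    refine ⟨k, ?_⟩
    rw [div_le_iff₀ (by positivity)]
    rw [div_le_iff₀ hlpos] at hk
    nlinarith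
  classical
  let k0 := Nat.find hex
  have s0 : ∀ w : ℝ, HasSum (fun k : ℕ => bC ν k * w ^ k * (1 / (ν + k + 1) - l))
      (bU (ν + 1) w - l * bU ν w) := by
    intro w
    have h := (bU_summable hν1 w).hasSum.sub ((bU_summable hν w).hasSum.mul_left l)
    have hf : (fun k : ℕ => bC ν k * w ^ k * (1 / (ν + k + 1) - l)) =
        fun k : ℕ => bC (ν + 1) k * w ^ k - l * (bC ν k * w ^ k) := by
      funext k
      rw [bC_shift hν]; ring
    rw [hf]
    exact h
  have h1 := (s0 z).sub ((s0 y).mul_left (t ^ k0))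
  have h2 : bU (ν + 1) y - l * bU ν y = 0 := by rw [hl]; field_simp; ring
  rw [h2, mul_zero, sub_zero] at h1
  have h3 : bU (ν + 1) z - l * bU ν z ≤ 0 := by
    refine hasSum_le (fun k => ?_) h1 hasSum_zero
    have hzk : z ^ k = y ^ k * t ^ k := by rw [← mul_pow, ht]; congr 1; field_simp
    have e : bC ν k * z ^ k * (1 / (ν + k + 1) - l) -
        t ^ k0 * (bC ν k * y ^ k * (1 / (ν + k + 1) - l))
        = bC ν k * y ^ k * ((1 / (ν + k + 1) - l) * (t ^ k - t ^ k0)) := by rw [hzk]; ring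
    rw [e]
    have hc := bC_pos hν k
    refine mul_nonpos_of_nonneg_of_nonpos (by positivity) ?_
    rcases lt_or_ge k k0 with hk | hk
    · have := Nat.find_min hex hk
      push Not at this
      refine mul_nonpos_of_nonneg_of_nonpos (by linarith) ?_
      have := pow_le_pow_right₀ ht1 hk.le
      linarith
    · have hf : 1 / (ν + (k0:ℝ) + 1) ≤ l := Nat.find_spec hex
      have hkk : (k0 : ℝ) ≤ k := by exact_mod_cast hk
      have h5 : 1 / (ν + (k:ℝ) + 1) ≤ 1 / (ν + (k0:ℝ) + 1) := by gcongr
      refine mul_nonpos_of_nonpos_of_nonneg (by linarith) ?_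
      have := pow_le_pow_right₀ ht1 hk
      linarith
  have h4 : l * bU ν y = bU (ν + 1) y := by linarith
  calc bU (ν + 1) z * bU ν y ≤ (l * bU ν z) * bU ν y := by
        gcongr
        linarith
    _ = (l * bU ν y) * bU ν z := by ring
    _ = _ := by rw [h4]

lemma besselI_eq {ν x : ℝ} (hx : 0 < x) :
    besselI ν x = (x / 2) ^ ν * bU ν (x ^ 2 / 4) := by
  unfold besselI bU
  rw [← tsum_mul_left]
  refine tsum_congr fun k => ?_
  have h : (2 * (k : ℝ)) = ((2 * k : ℕ) : ℝ) := by push_cast; ring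
  rw [Real.rpow_add (by positivity), h, Real.rpow_natCast, pow_mul]
  have h2 : (x / 2) ^ 2 = x ^ 2 / 4 := by ring
  rw [h2]
  unfold bC
  ring

lemma besselI_deriv {ν x : ℝ} (hν : 0 ≤ ν) (hx : 0 < x) :
    deriv (besselI ν) x =
      (x / 2) ^ ν * (ν / x * bU ν (x ^ 2 / 4) + x / 2 * bU (ν + 1) (x ^ 2 / 4)) := by
  have hx2 : x / 2 ≠ 0 := by positivity
  have h1 : HasDerivAt (fun x : ℝ => (x / 2) ^ ν) (1 / 2 * ν * (x / 2) ^ (ν - 1)) x :=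
    ((hasDerivAt_id x).div_const 2).rpow_const (Or.inl hx2)
  have h2 : HasDerivAt (fun x : ℝ => x ^ 2 / 4) (x / 2) x := by
    have := (hasDerivAt_pow 2 x).div_const 4
    exact this.congr_deriv (by push_cast; ring)
  have h3 := (bU_hasDerivAt hν (x ^ 2 / 4)).comp x h2
  have h4 := h1.mul h3
  have h5 : besselI ν =ᶠ[nhds x] (fun x : ℝ => (x / 2) ^ ν) * (bU ν ∘ fun x : ℝ => x ^ 2 / 4) := by
    filter_upwards [lt_mem_nhds hx] with w hw
    exact besselI_eq hw
  rw [(h4.congr_of_eventuallyEq h5).deriv, Real.rpow_sub_one hx2]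
  simp only [Function.comp]
  field_simp

lemma besselI_pos {ν x : ℝ} (hν : 0 ≤ ν) (hx : 0 < x) : 0 < besselI ν x := by
  rw [besselI_eq hx]
  have := bU_pos hν (y := x ^ 2 / 4) (by positivity)
  positivity

lemma besselI_deriv_pos {ν x : ℝ} (hν : 0 ≤ ν) (hx : 0 < x) : 0 < deriv (besselI ν) x := by
  rw [besselI_deriv hν hx]
  have := bU_pos hν (y := x ^ 2 / 4) (by positivity)
  have := bU_pos (ν := ν + 1) (by linarith) (y := x ^ 2 / 4) (by positivity)
  positivity

lemma bK_integrable {ν a : ℝ} (hν : 0 ≤ ν) (ha : 0 < a) (j : ℕ) :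
    MeasureTheory.IntegrableOn
      (fun t : ℝ => Real.cosh t ^ j * (Real.exp (-a * Real.cosh t) * Real.cosh (ν * t)))
      (Set.Ioi 0) := by
  have hg : MeasureTheory.IntegrableOn
      (fun t : ℝ => Real.exp ((ν + j) ^ 2 / a) * Real.exp (-(a / 4) * t ^ 2)) (Set.Ioi 0) :=
    ((integrable_exp_neg_mul_sq (by positivity : 0 < a / 4)).const_mul _).integrableOn
  refine MeasureTheory.Integrable.mono' hg
    (Continuous.aestronglyMeasurable (by fun_prop)) ?_
  refine (MeasureTheory.ae_restrict_iff' measurableSet_Ioi).2 (Filter.Eventually.of_forall ?_)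
  intro t ht
  have ht : 0 < t := ht
  have hc : ∀ s : ℝ, 0 ≤ s → Real.cosh s ≤ Real.exp s := by
    intro s hs
    rw [Real.cosh_eq]
    have : Real.exp (-s) ≤ Real.exp s := Real.exp_le_exp.2 (by linarith)
    linarith
  have hsq : t ^ 2 / 2 ≤ Real.cosh t := by
    have h1 : Real.cosh t = 1 + 2 * Real.sinh (t / 2) ^ 2 := by
      have := Real.cosh_two_mul (t / 2)
      rw [show 2 * (t / 2) = t by ring, Real.cosh_sq] at this
      linarith
    have h2 : t / 2 ≤ Real.sinh (t / 2) := Real.self_le_sinh_iff.2 (by positivity)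
    nlinarith
  have p1 := Real.cosh_pos t
  have p2 := Real.cosh_pos (ν * t)
  rw [Real.norm_eq_abs, abs_of_pos (by positivity)]
  calc Real.cosh t ^ j * (Real.exp (-a * Real.cosh t) * Real.cosh (ν * t))
      ≤ Real.exp t ^ j * (Real.exp (-a * (t ^ 2 / 2)) * Real.exp (ν * t)) := by
        gcongr ?_ ^ j * (Real.exp ?_ * ?_)
        · exact hc t ht.le
        · nlinarith
        · exact hc _ (by positivity)
    _ = Real.exp (j * t + (-a * (t ^ 2 / 2) + ν * t)) := by
        rw [← Real.exp_nat_mul, ← Real.exp_add, ← Real.exp_add]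
    _ ≤ Real.exp ((ν + j) ^ 2 / a + -(a / 4) * t ^ 2) := by
        apply Real.exp_le_exp.2
        have : (ν + j) ^ 2 / a + -(a / 4) * t ^ 2 - (j * t + (-a * (t ^ 2 / 2) + ν * t))
          = ((ν + j) - a * t / 2) ^ 2 / a := by field_simp; ring
        have h0 : 0 ≤ ((ν + j) - a * t / 2) ^ 2 / a := by positivity
        linarith
    _ = _ := by rw [Real.exp_add]

lemma bK_integral_pos {ν a : ℝ} (hν : 0 ≤ ν) (ha : 0 < a) (j : ℕ) :
    0 < ∫ t in Set.Ioi (0:ℝ),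
      Real.cosh t ^ j * (Real.exp (-a * Real.cosh t) * Real.cosh (ν * t)) := by
  have hp : ∀ t : ℝ, 0 < Real.cosh t ^ j * (Real.exp (-a * Real.cosh t) * Real.cosh (ν * t)) := by
    intro t
    have p1 := Real.cosh_pos t
    have p2 := Real.cosh_pos (ν * t)
    positivity
  rw [MeasureTheory.integral_pos_iff_support_of_nonneg (fun t => (hp t).le)
    (bK_integrable hν ha j)]
  have : Function.support (fun t : ℝ =>
      Real.cosh t ^ j * (Real.exp (-a * Real.cosh t) * Real.cosh (ν * t))) = Set.univ := by
    ext t; simpa using (hp t).ne'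
  rw [this]
  simp

lemma besselK_pos {ν x : ℝ} (hν : 0 ≤ ν) (hx : 0 < x) : 0 < besselK ν x := by
  simpa [besselK] using bK_integral_pos hν hx 0

lemma besselK_deriv_neg {ν x : ℝ} (hν : 0 ≤ ν) (hx : 0 < x) : deriv (besselK ν) x < 0 := by
  have hx2 : 0 < x / 2 := by positivity
  have key := hasDerivAt_integral_of_dominated_loc_of_deriv_le
    (μ := MeasureTheory.volume.restrict (Set.Ioi (0:ℝ)))
    (F := fun (x t : ℝ) => Real.exp (-x * Real.cosh t) * Real.cosh (ν * t))
    (F' := fun (x t : ℝ) =>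
      -(Real.cosh t ^ 1 * (Real.exp (-x * Real.cosh t) * Real.cosh (ν * t))))
    (bound := fun t : ℝ =>
      Real.cosh t ^ 1 * (Real.exp (-(x / 2) * Real.cosh t) * Real.cosh (ν * t)))
    (x₀ := x) (s := Metric.ball x (x / 2)) (Metric.ball_mem_nhds x hx2)
    (Filter.Eventually.of_forall fun w => Continuous.aestronglyMeasurable (by fun_prop))
    (by simpa [MeasureTheory.IntegrableOn] using bK_integrable hν hx 0)
    (Continuous.aestronglyMeasurable (by fun_prop))
    (Filter.Eventually.of_forall fun t w hw => by
      have p1 := Real.cosh_pos t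
      have p2 := Real.cosh_pos (ν * t)
      rw [norm_neg, Real.norm_eq_abs, abs_of_pos (by positivity)]
      have hw' : x / 2 ≤ w := by
        rw [Metric.mem_ball, Real.dist_eq, abs_lt] at hw
        linarith [hw.1]
      gcongr)
    (bK_integrable hν hx2 1)
    (Filter.Eventually.of_forall fun t w hw => by
      have h1 : HasDerivAt (fun w : ℝ => -w * Real.cosh t) (-1 * Real.cosh t) w :=
        ((hasDerivAt_id w).neg).mul_const _
      have h2 := (h1.exp).mul_const (Real.cosh (ν * t))
      exact h2.congr_deriv (by ring))
  have h : deriv (besselK ν) x = _ := key.2.deriv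
  rw [h, MeasureTheory.integral_neg]
  have := bK_integral_pos hν hx 1
  linarith

lemma wronskian_pos {ν x : ℝ} (hν : 0 ≤ ν) (hx : 0 < x) :
    0 < deriv (besselI ν) x * besselK ν x - deriv (besselK ν) x * besselI ν x := by
  have h1 := mul_pos (besselI_deriv_pos hν hx) (besselK_pos hν hx)
  have h2 := mul_pos (neg_pos.2 (besselK_deriv_neg hν hx)) (besselI_pos hν hx)
  linarith

/-- Strict monotonicity of the flux ratio in the conductivity, cross-multiplied. -/
lemma flux_mono {ν r s t : ℝ} (hν : 0 ≤ ν) (hr : 0 < r) (hs : 0 < s) (hst : s < t) :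
    s * deriv (besselI ν) (r / Real.sqrt s) * besselI ν (r / Real.sqrt t) <
      t * deriv (besselI ν) (r / Real.sqrt t) * besselI ν (r / Real.sqrt s) := by
  have ht : 0 < t := hs.trans hst
  have hss := Real.sqrt_pos.2 hs
  have hts := Real.sqrt_pos.2 ht
  have hlt : Real.sqrt s < Real.sqrt t := Real.sqrt_lt_sqrt hs.le hst
  obtain ⟨p, hp⟩ : ∃ p, p = Real.sqrt s := ⟨_, rfl⟩
  obtain ⟨q, hq⟩ : ∃ q, q = Real.sqrt t := ⟨_, rfl⟩
  have hsp : s = p ^ 2 := by rw [hp, Real.sq_sqrt hs.le]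
  have htq : t = q ^ 2 := by rw [hq, Real.sq_sqrt ht.le]
  rw [← hp] at hss hlt ⊢
  rw [← hq] at hts hlt ⊢
  rw [hsp, htq]
  have hx : 0 < r / p := by positivity
  have hy : 0 < r / q := by positivity
  have hxy : r / q ≤ r / p := by gcongr
  rw [besselI_deriv hν hx, besselI_deriv hν hy, besselI_eq hx, besselI_eq hy]
  have hν1 : 0 ≤ ν + 1 := by linarith
  have hr1 := bU_ratio hν (y := (r / q) ^ 2 / 4) (z := (r / p) ^ 2 / 4) (by positivity) (by gcongr)
  have u1 := bU_pos hν (y := (r / p) ^ 2 / 4) (by positivity)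
  have u2 := bU_pos hν (y := (r / q) ^ 2 / 4) (by positivity)
  have v1 := bU_pos hν1 (y := (r / p) ^ 2 / 4) (by positivity)
  have v2 := bU_pos hν1 (y := (r / q) ^ 2 / 4) (by positivity)
  have e1 : 0 < (r / p / 2) ^ ν := by positivity
  have e2 : 0 < (r / q / 2) ^ ν := by positivity
  generalize bU ν ((r / p) ^ 2 / 4) = U1 at *
  generalize bU ν ((r / q) ^ 2 / 4) = U2 at *
  generalize bU (ν + 1) ((r / p) ^ 2 / 4) = V1 at *
  generalize bU (ν + 1) ((r / q) ^ 2 / 4) = V2 at *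
  generalize (r / p / 2) ^ ν = E1 at *
  generalize (r / q / 2) ^ ν = E2 at *
  have l1 : p ^ 2 * (E1 * (ν / (r / p) * U1 + r / p / 2 * V1)) * (E2 * U2)
      = E1 * E2 * (ν / r * (U1 * U2) * p ^ 3 + r / 2 * (p * (V1 * U2))) := by
    field_simp
  have l2 : q ^ 2 * (E2 * (ν / (r / q) * U2 + r / q / 2 * V2)) * (E1 * U1)
      = E1 * E2 * (ν / r * (U1 * U2) * q ^ 3 + r / 2 * (q * (V2 * U1))) := by
    field_simp
  rw [l1, l2]
  have m1 : p * (V1 * U2) < q * (V2 * U1) :=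
    mul_lt_mul hlt hr1 (by positivity) hts.le
  have m2 : ν / r * (U1 * U2) * p ^ 3 ≤ ν / r * (U1 * U2) * q ^ 3 := by gcongr
  have m3 : r / 2 * (p * (V1 * U2)) < r / 2 * (q * (V2 * U1)) :=
    mul_lt_mul_of_pos_left m1 (by positivity)
  exact mul_lt_mul_of_pos_left (add_lt_add_of_le_of_lt m2 m3) (mul_pos e1 e2)

theorem uniqueness_from_multiplier (ν r₁ σ₁ σ₂ : ℝ) (hν : 0 ≤ ν)
    (hr₁ : r₁ ∈ Set.Ioo (0 : ℝ) 1) (hσ₁ : 0 < σ₁) (hσ₂ : 0 < σ₂)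
    (hden₁ : besselI ν (r₁ / Real.sqrt σ₁) * D11 ν 1 r₁ -
      σ₁ * deriv (besselI ν) (r₁ / Real.sqrt σ₁) * D10 ν 1 r₁ ≠ 0)
    (hden₂ : besselI ν (r₁ / Real.sqrt σ₂) * D11 ν 1 r₁ -
      σ₂ * deriv (besselI ν) (r₁ / Real.sqrt σ₂) * D10 ν 1 r₁ ≠ 0)
    (heq : (besselI ν (r₁ / Real.sqrt σ₁) * D01 ν 1 r₁ -
        σ₁ * deriv (besselI ν) (r₁ / Real.sqrt σ₁) * D ν 1 r₁) /
      (besselI ν (r₁ / Real.sqrt σ₁) * D11 ν 1 r₁ -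
        σ₁ * deriv (besselI ν) (r₁ / Real.sqrt σ₁) * D10 ν 1 r₁) =
      (besselI ν (r₁ / Real.sqrt σ₂) * D01 ν 1 r₁ -
        σ₂ * deriv (besselI ν) (r₁ / Real.sqrt σ₂) * D ν 1 r₁) /
      (besselI ν (r₁ / Real.sqrt σ₂) * D11 ν 1 r₁ -
        σ₂ * deriv (besselI ν) (r₁ / Real.sqrt σ₂) * D10 ν 1 r₁)) :
    σ₁ = σ₂ := by
  obtain ⟨hr0, hr1⟩ := hr₁
  have w1 := wronskian_pos hν (x := 1) one_pos
  have w2 := wronskian_pos hν hr0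
  rw [div_eq_div_iff hden₁ hden₂] at heq
  have hw := (mul_pos w1 w2).ne'
  have hz : (deriv (besselI ν) 1 * besselK ν 1 - deriv (besselK ν) 1 * besselI ν 1) *
      (deriv (besselI ν) r₁ * besselK ν r₁ - deriv (besselK ν) r₁ * besselI ν r₁) *
      (σ₁ * deriv (besselI ν) (r₁ / Real.sqrt σ₁) * besselI ν (r₁ / Real.sqrt σ₂) -
      σ₂ * deriv (besselI ν) (r₁ / Real.sqrt σ₂) * besselI ν (r₁ / Real.sqrt σ₁)) = 0 := by
    unfold D D01 D10 D11 at heq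
    linear_combination -heq
  have h0 := (mul_eq_zero.1 hz).resolve_left hw
  rcases lt_trichotomy σ₁ σ₂ with h | h | h
  · have := flux_mono hν hr0 hσ₁ h
    linarith
  · exact h
  · have := flux_mono hν hr0 hσ₂ h
    linarith
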